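/- Let p ≥ 1. For every maximal proper two-sided ideal J of B_{p,2}, the quotient B_{p,2}/J is a finite-dimensional complex vector space of dimension either 1 or p². In particular, the maximal two-sided ideals of B_{p,2} have at most two distinct codimensions. -/

import Mathlib

noncomputable section

/-- The closed bidisk `{(z,w) : ‖z‖ ≤ 1, ‖w‖ ≤ 1}` in `ℂ²`. -/
def Bidisk : Set (ℂ × ℂ) := Metric.closedBall 0 1 ×ˢ Metric.closedBall 0 1

instance : CompactSpace Bidisk :=
  isCompact_iff_compactSpace.mp ((isCompact_closedBall _ _).prod (isCompact_closedBall _ _))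

/-- The point `(0,0)` of the closed bidisk. -/
def pt0 : Bidisk := ⟨(0, 0), by simp [Bidisk]⟩

/-- `g` has the two-variable power series expansion with coefficients `a`,
converging at every point of the open bidisk. -/
def HasCoeffsAt (g : Bidisk → ℂ) (a : ℕ → ℕ → ℂ) : Prop :=
  ∀ p : Bidisk, ‖(p : ℂ × ℂ).1‖ < 1 → ‖(p : ℂ × ℂ).2‖ < 1 →
    HasSum (fun mn : ℕ × ℕ => a mn.1 mn.2 * (p : ℂ × ℂ).1 ^ mn.1 * (p : ℂ × ℂ).2 ^ mn.2) (g p)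

/-- Membership in `B_{k,2}`: a continuous `M_k(ℂ)`-valued function on the closed bidisk whose
`(i,j)` entry is given on the open bidisk by a power series whose coefficients `a m n` vanish
unless `m + n ≡ i - j (mod k)`. -/
def memBk2 (k : ℕ) (F : C(Bidisk, Matrix (Fin k) (Fin k) ℂ)) : Prop :=
  ∀ i j : Fin k, ∃ a : ℕ → ℕ → ℂ,
    HasCoeffsAt (fun p => F p i j) a ∧
    ∀ m n : ℕ, ¬ Int.ModEq (k : ℤ) ((m : ℤ) + (n : ℤ)) ((i : ℤ) - (j : ℤ)) → a m n = 0

/-- `J` is a two-sided ideal of the subring of `R` with carrier set `S`. -/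
def IsIdealIn {R : Type*} [Ring R] (S J : Set R) : Prop :=
  J ⊆ S ∧ (0 : R) ∈ J ∧ (∀ f ∈ J, ∀ g ∈ J, f + g ∈ J) ∧ (∀ f ∈ J, -f ∈ J) ∧
    ∀ f ∈ S, ∀ g ∈ J, f * g ∈ J ∧ g * f ∈ J

/-- `J` is a maximal proper two-sided ideal of the subring of `R` with carrier set `S`. -/
def IsMaxIdealIn {R : Type*} [Ring R] (S J : Set R) : Prop :=
  IsIdealIn S J ∧ J ≠ S ∧ ∀ J' : Set R, IsIdealIn S J' → J ⊆ J' → J' = J ∨ J' = S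

/-- The quotient of (the subalgebra with carrier) `S` by the ideal `J` has complex
dimension `d`: there are `d` elements of `S` whose classes mod `J` form a basis, i.e.
every `F ∈ S` is congruent mod `J` to a unique `ℂ`-linear combination of them. -/
def HasCodimIn {R : Type*} [Ring R] [Module ℂ R] (S J : Set R) (d : ℕ) : Prop :=
  ∃ g : Fin d → R, (∀ m : Fin d, g m ∈ S) ∧
    ∀ F ∈ S, ∃! c : Fin d → ℂ, F - ∑ m : Fin d, c m • g m ∈ J


/-! ### Ideals of subalgebras given by carrier sets -/

namespace IsIdealIn

variable {R : Type*} [Ring R] {S J : Set R}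

theorem add (h : IsIdealIn S J) {f g : R} (hf : f ∈ J) (hg : g ∈ J) : f + g ∈ J :=
  h.2.2.1 f hf g hg

theorem sub (h : IsIdealIn S J) {f g : R} (hf : f ∈ J) (hg : g ∈ J) : f - g ∈ J :=
  sub_eq_add_neg f g ▸ h.add hf (h.2.2.2.1 g hg)

theorem mul_left (h : IsIdealIn S J) {f g : R} (hf : f ∈ S) (hg : g ∈ J) : f * g ∈ J :=
  (h.2.2.2.2 f hf g hg).1

theorem mul_right (h : IsIdealIn S J) {f g : R} (hf : f ∈ J) (hg : g ∈ S) : f * g ∈ J :=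
  (h.2.2.2.2 g hg f hf).2

theorem sum (h : IsIdealIn S J) {ι : Type*} (s : Finset ι) {f : ι → R}
    (hf : ∀ i ∈ s, f i ∈ J) : ∑ i ∈ s, f i ∈ J := by
  classical
  induction s using Finset.induction_on with
  | empty => simpa using h.2.1
  | insert a s ha ih =>
    rw [Finset.sum_insert ha]
    exact h.add (hf a (by simp)) (ih fun i hi => hf i (by simp [hi]))

theorem eq_of_one_mem (h : IsIdealIn S J) (h1 : (1 : R) ∈ J) : J = S :=
  h.1.antisymm fun f hf => by simpa using h.mul_left hf h1

theorem preimage {R' : Type*} [Ring R'] (e : R' ≃+* R) (h : IsIdealIn S J) :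
    IsIdealIn (e ⁻¹' S) (e ⁻¹' J) := by
  obtain ⟨h1, h2, h3, h4, h5⟩ := h
  refine ⟨fun x hx => h1 hx, by simpa using h2, fun f hf g hg => ?_, fun f hf => ?_,
    fun f hf g hg => ⟨?_, ?_⟩⟩
  · simpa using h3 _ hf _ hg
  · simpa using h4 _ hf
  · simpa using (h5 _ hf _ hg).1
  · simpa using (h5 _ hf _ hg).2

end IsIdealIn

namespace IsMaxIdealIn

theorem preimage {R R' : Type*} [Ring R] [Ring R'] {S J : Set R} (e : R' ≃+* R)
    (h : IsMaxIdealIn S J) : IsMaxIdealIn (e ⁻¹' S) (e ⁻¹' J) := by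
  obtain ⟨h1, h2, h3⟩ := h
  refine ⟨h1.preimage e, fun h => h2 (e.surjective.preimage_injective h), fun J' hJ' hJJ' => ?_⟩
  have key : ∀ T : Set R, e.symm ⁻¹' J' = T → J' = e ⁻¹' T := by
    rintro T rfl
    ext x
    simp
  have hS : e.symm ⁻¹' (e ⁻¹' S) = S := by ext x; simp
  refine (h3 (e.symm ⁻¹' J') (hS ▸ hJ'.preimage e.symm) fun x hx => ?_).imp (key _) (key _)
  exact hJJ' (by simpa using hx)

variable {R : Type*} [Ring R] [Algebra ℂ R] {S : Subalgebra ℂ R} {J : Set R}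

theorem one_notMem (h : IsMaxIdealIn (S : Set R) J) : (1 : R) ∉ J := fun h1 =>
  h.2.1 (h.1.eq_of_one_mem h1)

theorem smul_mem (h : IsMaxIdealIn (S : Set R) J) (c : ℂ) {f : R} (hf : f ∈ J) : c • f ∈ J := by
  rw [Algebra.smul_def]
  exact h.1.mul_left (S.algebraMap_mem c) hf

/-- An ideal of `S` containing `J` and an element outside `J` contains `1`. -/
theorem one_mem_of_lt (h : IsMaxIdealIn (S : Set R) J) {J' : Set R} (h' : IsIdealIn (S : Set R) J')
    (hle : J ⊆ J') {a : R} (ha : a ∈ J') (ha' : a ∉ J) : (1 : R) ∈ J' := by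
  rcases h.2.2 J' h' hle with h | h
  · exact absurd (h ▸ ha) ha'
  · exact h ▸ S.one_mem

/-- Maximal two-sided ideals are prime. -/
theorem prime (h : IsMaxIdealIn (S : Set R) J) {a b : R} (ha : a ∈ S) (hb : b ∈ S)
    (hab : ∀ s ∈ S, a * s * b ∈ J) : a ∈ J ∨ b ∈ J := by
  refine or_iff_not_imp_left.2 fun haJ => ?_
  have hI : IsIdealIn (S : Set R) {c | c ∈ S ∧ ∀ s ∈ S, c * s * b ∈ J} := by
    refine ⟨fun c hc => hc.1, ⟨S.zero_mem, fun s _ => by simpa using h.1.2.1⟩,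
      fun c hc d hd => ⟨S.add_mem hc.1 hd.1, fun s hs => ?_⟩,
      fun c hc => ⟨S.neg_mem hc.1, fun s hs => ?_⟩,
      fun f hf c hc => ⟨⟨S.mul_mem hf hc.1, fun s hs => ?_⟩,
        ⟨S.mul_mem hc.1 hf, fun s hs => ?_⟩⟩⟩
    · rw [add_mul, add_mul]
      exact h.1.add (hc.2 s hs) (hd.2 s hs)
    · rw [neg_mul, neg_mul]
      exact h.1.2.2.2.1 _ (hc.2 s hs)
    · rw [mul_assoc f, mul_assoc f]
      exact h.1.mul_left hf (hc.2 s hs)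
    · rw [mul_assoc c]
      exact hc.2 _ (S.mul_mem hf hs)
  have := h.one_mem_of_lt hI (fun c hc => ⟨h.1.1 hc, fun s hs =>
    h.1.mul_right (h.1.mul_right hc hs) hb⟩) ⟨ha, hab⟩ haJ
  simpa using this.2 1 S.one_mem

end IsMaxIdealIn

theorem HasCodimIn.of_preimage {R R' : Type*} [Ring R] [Module ℂ R] [Ring R'] [Module ℂ R']
    {S J : Set R} {d : ℕ} (e : R' ≃+* R) (he : ∀ (c : ℂ) (x : R'), e (c • x) = c • e x)
    (h : HasCodimIn (e ⁻¹' S) (e ⁻¹' J) d) : HasCodimIn S J d := by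
  obtain ⟨g, hg, h⟩ := h
  refine ⟨fun m => e (g m), hg, fun F hF => ?_⟩
  simpa [he] using h (e.symm F) (by simpa using hF)

/-- The codimension of the kernel of a linear map is the dimension of its range. -/
theorem HasCodimIn.of_linearMap {R V : Type*} [Ring R] [Algebra ℂ R] [AddCommGroup V] [Module ℂ V]
    [FiniteDimensional ℂ V] {S : Subalgebra ℂ R} {J : Set R} (φ : R →ₗ[ℂ] V)
    (hφ : ∀ v, ∃ F ∈ S, φ F = v) (hJ : ∀ F ∈ S, F ∈ J ↔ φ F = 0) :
    HasCodimIn (S : Set R) J (Module.finrank ℂ V) := by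
  let b := Module.finBasis ℂ V
  choose g hgS hg using fun m => hφ (b m)
  refine ⟨g, hgS, fun F hF => ⟨fun m => b.repr (φ F) m, ?_, fun c hc => ?_⟩⟩
  · refine (hJ _ (S.sub_mem hF (S.sum_mem fun m _ => S.smul_mem (hgS m) _))).2 ?_
    simp [hg, b.sum_repr]
  · have := (hJ _ (S.sub_mem hF (S.sum_mem fun m _ => S.smul_mem (hgS m) _))).1 hc
    rw [map_sub, sub_eq_zero] at this
    rw [this]
    ext m
    simp only [map_sum, map_smul, hg, b.repr_self]
    simp [Finsupp.single_apply]

/-! ### Matrices of homogeneous elements -/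

section Graded

variable {C : Type*} [CommRing C] [Algebra ℂ C] (A : ℤ → Submodule ℂ C) [SetLike.GradedMonoid A]

/-- Matrices whose `(i, j)` entry has degree `i - j`. -/
def gradedMatrix (p : ℕ) : Subalgebra ℂ (Matrix (Fin p) (Fin p) C) where
  carrier := {F | ∀ i j : Fin p, F i j ∈ A ((i : ℤ) - (j : ℤ))}
  mul_mem' {F G} hF hG i j := by
    rw [Matrix.mul_apply]
    refine Submodule.sum_mem _ fun k _ => ?_
    simpa using SetLike.mul_mem_graded (hF i k) (hG k j)
  add_mem' {F G} hF hG i j := Submodule.add_mem _ (hF i j) (hG i j)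
  algebraMap_mem' c i j := by
    rw [Algebra.algebraMap_eq_smul_one, Matrix.smul_apply]
    refine Submodule.smul_mem _ _ ?_
    rcases eq_or_ne i j with rfl | h
    · simpa using SetLike.one_mem_graded A
    · simp [Matrix.one_apply_ne h]

variable {A}

theorem single_mem_gradedMatrix {p : ℕ} {i j : Fin p} {f : C} (hf : f ∈ A ((i : ℤ) - (j : ℤ))) :
    Matrix.single i j f ∈ gradedMatrix A p := fun k l => by
  rw [Matrix.single_apply]
  split_ifs with h
  · rwa [← h.1, ← h.2]
  · exact Submodule.zero_mem _

theorem single_self_mem_gradedMatrix {p : ℕ} {i : Fin p} {f : C} (hf : f ∈ A 0) :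
    Matrix.single i i f ∈ gradedMatrix A p :=
  single_mem_gradedMatrix (by simpa using hf)

theorem smul_mem_gradedMatrix {p : ℕ} {f : C} (hf : f ∈ A 0) {F : Matrix (Fin p) (Fin p) C}
    (hF : F ∈ gradedMatrix A p) : f • F ∈ gradedMatrix A p := fun i j => by
  simpa using SetLike.mul_mem_graded hf (hF i j)

/-- A determinant of homogeneous elements is homogeneous. -/
theorem det_mem_graded {p : ℕ} (r s : Fin p → ℤ) {M : Matrix (Fin p) (Fin p) C}
    (hM : ∀ i j, M i j ∈ A (r i - s j)) : M.det ∈ A (∑ i, r i - ∑ i, s i) := by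
  rw [Matrix.det_apply]
  refine Submodule.sum_mem _ fun σ _ => ?_
  have : ∏ i, M (σ i) i ∈ A (∑ i, r i - ∑ i, s i) := by
    have := SetLike.prod_mem_graded A (F := Finset.univ) (fun i => r (σ i) - s i) (fun i => M (σ i) i)
      fun i _ => hM _ _
    rwa [Finset.sum_sub_distrib, Equiv.sum_comp σ r] at this
  rcases Int.units_eq_one_or (Equiv.Perm.sign σ) with h | h <;> simpa [h] using this

theorem prod_sub_prod_mem_graded {ι : Type*} (s : Finset ι) (d : ι → ℤ) {f g : ι → C} {x : C}
    (hf : ∀ i ∈ s, f i ∈ A (d i)) (hg : ∀ i ∈ s, g i ∈ A (d i))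
    (hfg : ∀ i ∈ s, ∃ y ∈ A (d i), f i - g i = x * y) :
    ∃ y ∈ A (∑ i ∈ s, d i), ∏ i ∈ s, f i - ∏ i ∈ s, g i = x * y := by
  classical
  induction s using Finset.induction_on with
  | empty => exact ⟨0, Submodule.zero_mem _, by simp⟩
  | insert a s ha ih =>
    simp only [Finset.forall_mem_insert] at hf hg hfg
    obtain ⟨y, hy, e⟩ := ih hf.2 hg.2 hfg.2
    obtain ⟨z, hz, e'⟩ := hfg.1
    rw [Finset.sum_insert ha]
    refine ⟨z * ∏ i ∈ s, f i + g a * y, Submodule.add_mem _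
      (SetLike.mul_mem_graded hz (SetLike.prod_mem_graded A d f hf.2))
      (SetLike.mul_mem_graded hg.1 hy), ?_⟩
    rw [Finset.prod_insert ha, Finset.prod_insert ha]
    linear_combination (∏ i ∈ s, f i) * e' + g a * e

theorem exists_det_one_sub_smul {p : ℕ} {f : C} (hf : f ∈ A 0) {b : Matrix (Fin p) (Fin p) C}
    (hb : b ∈ gradedMatrix A p) : ∃ g ∈ A 0, (1 - f • b).det = 1 - f * g := by
  have hM : 1 - f • b ∈ gradedMatrix A p :=
    Subalgebra.sub_mem _ (Subalgebra.one_mem _) (smul_mem_gradedMatrix hf hb)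
  have h1 : (1 : Matrix (Fin p) (Fin p) C) ∈ gradedMatrix A p := Subalgebra.one_mem _
  have key : ∀ σ : Equiv.Perm (Fin p), ∃ y ∈ A 0, ∏ i, (1 - f • b) (σ i) i
      - ∏ i, (1 : Matrix (Fin p) (Fin p) C) (σ i) i = f * y := by
    intro σ
    have := prod_sub_prod_mem_graded (A := A) (x := f) Finset.univ
      (fun i => ((σ i : ℕ) : ℤ) - (i : ℕ)) (fun i _ => hM (σ i) i) (fun i _ => h1 (σ i) i)
      fun i _ => ⟨-b (σ i) i, Submodule.neg_mem _ (hb _ _), by simp⟩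
    rwa [Finset.sum_sub_distrib, Equiv.sum_comp σ (fun i => ((i : ℕ) : ℤ)), sub_self] at this
  choose y hy e using key
  refine ⟨-∑ σ, (Equiv.Perm.sign σ : ℤ) • y σ, Submodule.neg_mem _
    (Submodule.sum_mem _ fun σ _ => ?_), ?_⟩
  · rcases Int.units_eq_one_or (Equiv.Perm.sign σ) with h | h <;> simpa [h] using hy σ
  · have h : (1 - f • b).det - (1 : Matrix (Fin p) (Fin p) C).det
        = f * ∑ σ, (Equiv.Perm.sign σ : ℤ) • y σ := by
      rw [Matrix.det_apply', Matrix.det_apply', ← Finset.sum_sub_distrib, Finset.mul_sum]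
      refine Finset.sum_congr rfl fun σ _ => ?_
      rw [← mul_sub, e, zsmul_eq_mul]
      ring
    rw [Matrix.det_one] at h
    linear_combination h

theorem adjugate_mem_gradedMatrix {p : ℕ} {M : Matrix (Fin p) (Fin p) C}
    (hM : M ∈ gradedMatrix A p) : M.adjugate ∈ gradedMatrix A p := fun i l => by
  rw [Matrix.adjugate_apply]
  have := det_mem_graded (A := A) (Function.update (fun k : Fin p => ((k : ℕ) : ℤ)) l (i : ℕ))
    (fun k : Fin p => ((k : ℕ) : ℤ)) (M := M.updateRow l (Pi.single i 1)) fun k m => by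
      rcases eq_or_ne k l with rfl | h
      · rw [Matrix.updateRow_self, Function.update_self, Pi.single_apply]
        split_ifs with h
        · simpa [h] using SetLike.one_mem_graded A
        · exact Submodule.zero_mem _
      · rw [Matrix.updateRow_ne h, Function.update_of_ne h]
        exact hM k m
  rw [Finset.sum_update_of_mem (Finset.mem_univ l), ← Finset.sum_erase_add _ _ (Finset.mem_univ l),
    Finset.sdiff_singleton_eq_erase] at this
  convert! this using 2
  ring

variable {p : ℕ} {J : Set (Matrix (Fin p) (Fin p) C)}

theorem det_smul_one_mem (hJ : IsIdealIn (gradedMatrix A p : Set _) J)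
    {M : Matrix (Fin p) (Fin p) C} (hM : M ∈ J) :
    M.det • (1 : Matrix (Fin p) (Fin p) C) ∈ J := by
  rw [← Matrix.mul_adjugate]
  exact hJ.mul_right hM (adjugate_mem_gradedMatrix (hJ.1 hM))

/-- The degree-zero scalars in a maximal two-sided ideal form a maximal ideal. -/
theorem exists_one_sub_mul_smul_one_mem (hJ : IsMaxIdealIn (gradedMatrix A p : Set _) J) {f : C}
    (hf : f ∈ A 0) (hfJ : f • (1 : Matrix (Fin p) (Fin p) C) ∉ J) :
    ∃ g ∈ A 0, (1 - f * g) • (1 : Matrix (Fin p) (Fin p) C) ∈ J := by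
  have hI : IsIdealIn (gradedMatrix A p : Set (Matrix (Fin p) (Fin p) C))
      {F | ∃ j ∈ J, ∃ b ∈ gradedMatrix A p, F = j + f • b} := by
    refine ⟨?_, ⟨0, hJ.1.2.1, 0, Subalgebra.zero_mem _, by simp⟩, ?_, ?_, ?_⟩
    · rintro _ ⟨j, hj, b, hb, rfl⟩
      exact Subalgebra.add_mem _ (hJ.1.1 hj) (smul_mem_gradedMatrix hf hb)
    · rintro _ ⟨j, hj, b, hb, rfl⟩ _ ⟨j', hj', b', hb', rfl⟩
      exact ⟨j + j', hJ.1.add hj hj', b + b', Subalgebra.add_mem _ hb hb', by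
        rw [smul_add]; abel⟩
    · rintro _ ⟨j, hj, b, hb, rfl⟩
      exact ⟨-j, hJ.1.2.2.2.1 j hj, -b, Subalgebra.neg_mem _ hb, by rw [smul_neg]; abel⟩
    · rintro s hs _ ⟨j, hj, b, hb, rfl⟩
      exact ⟨⟨s * j, hJ.1.mul_left hs hj, s * b, Subalgebra.mul_mem _ hs hb, by
        rw [mul_add, mul_smul_comm]⟩, ⟨j * s, hJ.1.mul_right hj hs, b * s,
        Subalgebra.mul_mem _ hb hs, by rw [add_mul, smul_mul_assoc]⟩⟩
  obtain ⟨j, hj, b, hb, e⟩ := hJ.one_mem_of_lt hI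
    (fun j hj => ⟨j, hj, 0, Subalgebra.zero_mem _, by simp⟩)
    (a := f • 1) ⟨0, hJ.1.2.1, 1, Subalgebra.one_mem _, by simp⟩ hfJ
  obtain ⟨g, hg, hd⟩ := exists_det_one_sub_smul hf hb
  refine ⟨g, hg, ?_⟩
  rw [← hd, sub_eq_of_eq_add e]
  exact det_smul_one_mem hJ.1 hj

theorem smul_mem_of_smul_one_mem (hJ : IsIdealIn (gradedMatrix A p : Set _) J) {f : C}
    (hf : f • (1 : Matrix (Fin p) (Fin p) C) ∈ J) {F : Matrix (Fin p) (Fin p) C}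
    (hF : F ∈ gradedMatrix A p) : f • F ∈ J := by
  simpa using hJ.mul_right hf hF

theorem mem_of_single_mem (hJ : IsIdealIn (gradedMatrix A p : Set _) J)
    {F : Matrix (Fin p) (Fin p) C} (hF : ∀ i j, Matrix.single i j (F i j) ∈ J) : F ∈ J := by
  rw [Matrix.matrix_eq_sum_single F]
  exact hJ.sum _ fun i _ => hJ.sum _ fun j _ => hF i j

theorem hasCodimIn_sq (hJ : IsMaxIdealIn (gradedMatrix A p : Set _) J)
    (hA : ∀ k l : ℤ, k ≡ l [ZMOD p] → A k = A l) (ev : C →ₐ[ℂ] ℂ)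
    (hev : ∀ f ∈ A 0, ev f = 0 → f • (1 : Matrix (Fin p) (Fin p) C) ∈ J)
    {t : C} (ht : t ∈ A 1) (ht0 : ev t ≠ 0) :
    HasCodimIn (gradedMatrix A p : Set _) J (p ^ 2) := by
  have htpow : ∀ (n : ℕ) (k : ℤ), (n : ℤ) ≡ k [ZMOD p] → t ^ n ∈ A k := fun n k h => by
    simpa [hA _ _ h] using SetLike.pow_mem_graded n ht
  have hdeg : ∀ i j : Fin p, (((i : ℕ) + (p - j) : ℕ) : ℤ) ≡ i - j [ZMOD p] := fun i j => by
    have := j.2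
    push_cast [this.le]
    exact (Int.modEq_iff_dvd.2 ⟨-1, by ring⟩)
  have hU : ∀ i j : Fin p, ∃ U ∈ gradedMatrix A p, U.map ev = Matrix.single i j (1 : ℂ) := by
    intro i j
    refine ⟨(ev t ^ ((i : ℕ) + (p - j)))⁻¹ • Matrix.single i j (t ^ ((i : ℕ) + (p - j))),
      Subalgebra.smul_mem _ (single_mem_gradedMatrix (htpow _ _ (hdeg i j))) _, ?_⟩
    ext k l
    simp only [Matrix.map_apply, Matrix.smul_apply, Matrix.single_apply, map_smul]
    split_ifs <;> simp [ht0]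
  choose U hUS hU using hU
  have hker : ∀ F ∈ gradedMatrix A p, F.map ev = 0 → F ∈ J := by
    intro F hF hF0
    refine mem_of_single_mem hJ.1 fun i j => ?_
    have hF0 : ev (F i j) = 0 := congrFun (congrFun hF0 i) j
    have h1 : ((ev t ^ (p + p)) • 1 - t ^ (p + p)) • Matrix.single i j (F i j) ∈ J := by
      refine smul_mem_of_smul_one_mem hJ.1 (hev _ (Submodule.sub_mem _ (Submodule.smul_mem _ _
        (SetLike.one_mem_graded A)) (htpow _ _ ?_)) (by simp)) (single_mem_gradedMatrix (hF i j))
      exact (Int.modEq_iff_dvd.2 ⟨-2, by push_cast; ring⟩)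
    have h2 : (F i j * t ^ ((j : ℕ) + (p - i))) • Matrix.single i j (t ^ ((i : ℕ) + (p - j))) ∈ J :=
      smul_mem_of_smul_one_mem hJ.1 (hev _
        (by simpa using SetLike.mul_mem_graded (hF i j) (htpow _ _ (hdeg j i))) (by simp [hF0]))
        (single_mem_gradedMatrix (htpow _ _ (hdeg i j)))
    have h3 := hJ.smul_mem ((ev t ^ (p + p))⁻¹) (hJ.1.add h1 h2)
    convert h3
    have e : (j : ℕ) + (p - i) + (i + (p - j)) = p + p := by omega
    rw [Matrix.smul_single, Matrix.smul_single, ← Matrix.single_add, Matrix.smul_single]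
    congr 1
    simp only [smul_eq_mul]
    rw [mul_assoc (F i j), ← pow_add, e, sub_mul, smul_mul_assoc, one_mul, mul_comm (F i j),
      sub_add_cancel, inv_smul_smul₀ (pow_ne_zero _ ht0)]
  have hfin : Module.finrank ℂ (Matrix (Fin p) (Fin p) ℂ) = p ^ 2 := by
    simp [Module.finrank_matrix, sq]
  rw [← hfin]
  refine HasCodimIn.of_linearMap ev.toLinearMap.mapMatrix (fun v => ?_) fun F hF =>
    ⟨fun hFJ => ?_, hker F hF⟩
  · refine ⟨∑ i, ∑ j, v i j • U i j, Subalgebra.sum_mem _ fun i _ => Subalgebra.sum_mem _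
      fun j _ => Subalgebra.smul_mem _ (hUS i j) _, ?_⟩
    have : ∀ i j, ev.toLinearMap.mapMatrix (U i j) = Matrix.single i j (1 : ℂ) := hU
    simp only [map_sum, map_smul, this]
    conv_rhs => rw [Matrix.matrix_eq_sum_single v]
    simp [Matrix.smul_single]
  · by_contra hne
    obtain ⟨a, b, hab⟩ : ∃ a b, ev (F a b) ≠ 0 := by
      by_contra! h
      exact hne (by ext a b; exact h a b)
    have hG : ∑ i, (ev (F a b))⁻¹ • (U i a * F * U b i) ∈ J := hJ.1.sum _ fun i _ =>
      hJ.smul_mem _ (hJ.1.mul_right (hJ.1.mul_left (hUS _ _) hFJ) (hUS _ _))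
    refine hJ.one_notMem ?_
    rw [← sub_add_cancel 1 (∑ i, (ev (F a b))⁻¹ • (U i a * F * U b i))]
    refine hJ.1.add (hker _ (Subalgebra.sub_mem _ (Subalgebra.one_mem _) (hJ.1.1 hG)) ?_) hG
    change ev.mapMatrix _ = 0
    have hU' : ∀ i j, ev.mapMatrix (U i j) = Matrix.single i j (1 : ℂ) := hU
    simp only [map_sub, map_one, map_sum, map_smul, map_mul, hU']
    rw [sub_eq_zero]
    simp [hab, Matrix.smul_single, ← Matrix.sum_single_one]

theorem hasCodimIn_one (hJ : IsMaxIdealIn (gradedMatrix A p : Set _) J) (ev : C →ₐ[ℂ] ℂ)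
    (hev : ∀ f ∈ A 0, ev f = 0 → f • (1 : Matrix (Fin p) (Fin p) C) ∈ J)
    (hev0 : ∀ k : ℤ, ¬ k ≡ 0 [ZMOD p] → ∀ f ∈ A k, ev f = 0) :
    HasCodimIn (gradedMatrix A p : Set _) J 1 := by
  have h1 : ∀ k : Fin p, Matrix.single k k (1 : C) ∈ gradedMatrix A p := fun k =>
    single_self_mem_gradedMatrix (SetLike.one_mem_graded A)
  have hoff : ∀ i j : Fin p, i ≠ j → ∀ f ∈ A ((i : ℤ) - (j : ℤ)), Matrix.single i j f ∈ J := by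
    intro i j hij f hf
    have hf0 : ev f = 0 := hev0 _ (fun h => hij (Fin.ext (by
      have := h.symm.dvd
      have := Int.eq_zero_of_abs_lt_dvd this (by rw [abs_lt]; omega)
      omega))) f hf
    have hS := single_mem_gradedMatrix hf
    refine (or_self_iff.1 (hJ.prime hS hS fun G hG => ?_))
    have : Matrix.single i j f * G * Matrix.single i j f
        = (f * G j i) • Matrix.single i j f := by
      simp [Matrix.single_mul_mul_single, Matrix.smul_single]
    rw [this]
    exact smul_mem_of_smul_one_mem hJ.1 (hev _
      (by simpa using SetLike.mul_mem_graded hf (hG j i)) (by simp [hf0])) hS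
  obtain ⟨i, hi⟩ : ∃ i : Fin p, Matrix.single i i (1 : C) ∉ J := by
    by_contra! h
    refine hJ.one_notMem ?_
    rw [← Matrix.sum_single_one]
    exact hJ.1.sum _ fun i _ => h i
  have hii : ∀ j : Fin p, j ≠ i → Matrix.single j j (1 : C) ∈ J := by
    intro j hj
    refine (hJ.prime (h1 i) (h1 j) fun G hG => ?_).resolve_left hi
    simpa [Matrix.single_mul_mul_single] using hoff i j hj.symm _ (hG i j)
  have hmem : ∀ F ∈ gradedMatrix A p, F - ev (F i i) • Matrix.single i i (1 : C) ∈ J := by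
    intro F hF
    refine mem_of_single_mem hJ.1 fun k l => ?_
    have hS : F - ev (F i i) • Matrix.single i i (1 : C) ∈ gradedMatrix A p :=
      Subalgebra.sub_mem _ hF (Subalgebra.smul_mem _ (h1 i) _)
    rcases eq_or_ne k l with rfl | hkl
    · rcases eq_or_ne k i with rfl | hk
      · have := smul_mem_of_smul_one_mem hJ.1 (hev (F k k - ev (F k k) • 1) (Submodule.sub_mem _
          (by simpa using hF k k) (Submodule.smul_mem _ _ (SetLike.one_mem_graded A)))
          (by simp)) (h1 k)
        simpa [Matrix.smul_single] using this
      · have h0 := hS k k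
        rw [sub_self] at h0
        have := hJ.1.mul_left (smul_mem_gradedMatrix h0 (h1 k)) (hii k hk)
        simpa [Matrix.smul_single] using this
    · exact hoff k l hkl _ (hS k l)
  rw [← Module.finrank_self ℂ]
  refine HasCodimIn.of_linearMap (ev.toLinearMap ∘ₗ Matrix.entryLinearMap ℂ C i i)
    (fun v => ⟨v • Matrix.single i i 1, Subalgebra.smul_mem _ (h1 i) _, by simp⟩) fun F hF =>
    ⟨fun hFJ => ?_, fun h => ?_⟩
  · by_contra h
    replace h : ev (F i i) ≠ 0 := h
    have := hJ.smul_mem (ev (F i i))⁻¹ (hJ.1.sub hFJ (hmem F hF))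
    rw [sub_sub_cancel, inv_smul_smul₀ h] at this
    exact hi this
  · replace h : ev (F i i) = 0 := h
    simpa [h] using hmem F hF

end Graded

/-! ### The bidisk algebra -/

namespace Bidisk

open Metric Filter Topology

/-- Scaling of the bidisk by a complex number of modulus at most one. -/
def scaleMap : C(closedBall (0 : ℂ) 1 × Bidisk, Bidisk) where
  toFun q := ⟨((q.1 : ℂ) * (q.2 : ℂ × ℂ).1, (q.1 : ℂ) * (q.2 : ℂ × ℂ).2), by
    obtain ⟨⟨c, hc⟩, ⟨⟨z, w⟩, hz, hw⟩⟩ := q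
    simp only [mem_closedBall_zero_iff] at hc hz hw
    simp only [Bidisk, Set.mem_prod, mem_closedBall_zero_iff, norm_mul]
    exact ⟨mul_le_one₀ hc (norm_nonneg _) hz, mul_le_one₀ hc (norm_nonneg _) hw⟩⟩
  continuous_toFun := by fun_prop

/-- Scaling of the bidisk by a fixed complex number. -/
def scale (c : closedBall (0 : ℂ) 1) : C(Bidisk, Bidisk) := scaleMap.curry c

@[simp] theorem scale_fst (c : closedBall (0 : ℂ) 1) (x : Bidisk) :
    (scale c x : ℂ × ℂ).1 = c * (x : ℂ × ℂ).1 := rfl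

@[simp] theorem scale_snd (c : closedBall (0 : ℂ) 1) (x : Bidisk) :
    (scale c x : ℂ × ℂ).2 = c * (x : ℂ × ℂ).2 := rfl

theorem ext {x y : Bidisk} (h1 : (x : ℂ × ℂ).1 = (y : ℂ × ℂ).1)
    (h2 : (x : ℂ × ℂ).2 = (y : ℂ × ℂ).2) : x = y := Subtype.ext (Prod.ext h1 h2)

theorem scale_one (x : Bidisk) : scale 1 x = x := ext (by simp) (by simp)

theorem scale_mul (c d : closedBall (0 : ℂ) 1) (x : Bidisk) :
    scale (c * d) x = scale c (scale d x) := ext (by simp [mul_assoc]) (by simp [mul_assoc])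

instance : Nonempty Bidisk := ⟨pt0⟩

theorem norm_fst_le (x : Bidisk) : ‖(x : ℂ × ℂ).1‖ ≤ 1 := by simpa using x.2.1

theorem norm_snd_le (x : Bidisk) : ‖(x : ℂ × ℂ).2‖ ≤ 1 := by simpa using x.2.2

theorem norm_scale_fst_lt {c : closedBall (0 : ℂ) 1} (hc : ‖(c : ℂ)‖ < 1) (x : Bidisk) :
    ‖(scale c x : ℂ × ℂ).1‖ < 1 := by
  rw [scale_fst, norm_mul]
  exact (mul_le_of_le_one_right (norm_nonneg _) (norm_fst_le x)).trans_lt hc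

theorem norm_scale_snd_lt {c : closedBall (0 : ℂ) 1} (hc : ‖(c : ℂ)‖ < 1) (x : Bidisk) :
    ‖(scale c x : ℂ × ℂ).2‖ < 1 := by
  rw [scale_snd, norm_mul]
  exact (mul_le_of_le_one_right (norm_nonneg _) (norm_snd_le x)).trans_lt hc

theorem continuous_comp_scale (f : C(Bidisk, ℂ)) : Continuous fun c => f.comp (scale c) :=
  (f.comp scaleMap).curry.continuous

theorem one_mem_of_isClosed {P : Set (closedBall (0 : ℂ) 1)} (hP : IsClosed P)
    (h : ∀ c : closedBall (0 : ℂ) 1, ‖(c : ℂ)‖ < 1 → c ∈ P) : 1 ∈ P := by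
  have hlt : ∀ n : ℕ, ‖((n / (n + 1) : ℝ) : ℂ)‖ < 1 := fun n => by
    rw [Complex.norm_real, Real.norm_of_nonneg (by positivity), div_lt_one (by positivity)]
    linarith
  have ht : Tendsto (fun n : ℕ => (n / (n + 1) : ℝ)) atTop (𝓝 1) := by
    simpa using tendsto_natCast_div_add_atTop (1 : ℝ)
  refine hP.mem_of_tendsto (b := atTop)
    (f := fun n : ℕ => ⟨((n / (n + 1) : ℝ) : ℂ), by simpa using (hlt n).le⟩) ?_
    (Eventually.of_forall fun n => h _ (hlt n))
  rw [tendsto_subtype_rng]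
  exact (Complex.continuous_ofReal.tendsto 1).comp ht

/-- The first coordinate function. -/
def coordFst : C(Bidisk, ℂ) := ⟨fun x => (x : ℂ × ℂ).1, by fun_prop⟩

/-- The second coordinate function. -/
def coordSnd : C(Bidisk, ℂ) := ⟨fun x => (x : ℂ × ℂ).2, by fun_prop⟩

@[simp] theorem coordFst_apply (x : Bidisk) : coordFst x = (x : ℂ × ℂ).1 := rfl

@[simp] theorem coordSnd_apply (x : Bidisk) : coordSnd x = (x : ℂ × ℂ).2 := rfl

/-- The bidisk algebra, as the closure of the polynomials in the two coordinates. -/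
def algebra : Subalgebra ℂ C(Bidisk, ℂ) :=
  (Algebra.adjoin ℂ {coordFst, coordSnd}).topologicalClosure

theorem isClosed_algebra : IsClosed (algebra : Set C(Bidisk, ℂ)) :=
  Subalgebra.isClosed_topologicalClosure _

theorem adjoin_le_algebra : Algebra.adjoin ℂ {coordFst, coordSnd} ≤ algebra :=
  Subalgebra.le_topologicalClosure _

theorem coordFst_mem : coordFst ∈ algebra := adjoin_le_algebra (Algebra.subset_adjoin (by simp))

theorem coordSnd_mem : coordSnd ∈ algebra := adjoin_le_algebra (Algebra.subset_adjoin (by simp))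

theorem algebra_induction {P : C(Bidisk, ℂ) → Prop} (hP : IsClosed {f | P f}) (h0 : P 0)
    (hadd : ∀ f g, P f → P g → P (f + g)) (hsmul : ∀ (c : ℂ) f, P f → P (c • f))
    (hmono : ∀ m n : ℕ, P (coordFst ^ m * coordSnd ^ n)) {f : C(Bidisk, ℂ)} (hf : f ∈ algebra) :
    P f := by
  refine closure_minimal (fun g hg => ?_) hP hf
  have hg' : g ∈ Subalgebra.toSubmodule (Algebra.adjoin ℂ {coordFst, coordSnd}) := hg
  clear hg
  rw [Algebra.adjoin_eq_span] at hg'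
  induction hg' using Submodule.span_induction with
  | mem x hx =>
    obtain ⟨m, n, rfl⟩ := (Submonoid.mem_closure_pair _ _ _).1 hx
    exact hmono m n
  | zero => exact h0
  | add x y _ _ hx hy => exact hadd x y hx hy
  | smul c x _ hx => exact hsmul c x hx

theorem comp_scale_mem {f : C(Bidisk, ℂ)} (hf : f ∈ algebra) (c : closedBall (0 : ℂ) 1) :
    f.comp (scale c) ∈ algebra := by
  refine algebra_induction (P := fun f => f.comp (scale c) ∈ algebra) ?_ ?_ ?_ ?_ ?_ hf
  · exact isClosed_algebra.preimage (ContinuousMap.continuous_precomp _)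
  · exact algebra.zero_mem
  · exact fun f g hf hg => algebra.add_mem hf hg
  · exact fun a f hf => algebra.smul_mem hf a
  · intro m n
    have : (coordFst ^ m * coordSnd ^ n).comp (scale c)
        = ((c : ℂ) ^ m * (c : ℂ) ^ n) • (coordFst ^ m * coordSnd ^ n) := by
      ext x
      simp
      ring
    rw [this]
    exact algebra.smul_mem (algebra.mul_mem (algebra.pow_mem coordFst_mem _)
      (algebra.pow_mem coordSnd_mem _)) _

theorem norm_coordFst_le : ‖coordFst‖ ≤ 1 :=
  (ContinuousMap.norm_le _ zero_le_one).2 norm_fst_le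

theorem norm_coordSnd_le : ‖coordSnd‖ ≤ 1 :=
  (ContinuousMap.norm_le _ zero_le_one).2 norm_snd_le

theorem norm_monomial_le (m n : ℕ) : ‖coordFst ^ m * coordSnd ^ n‖ ≤ 1 := by
  refine (norm_mul_le _ _).trans (mul_le_one₀ ?_ (norm_nonneg _) ?_)
  · exact (norm_pow_le _ _).trans (pow_le_one₀ (norm_nonneg _) norm_coordFst_le)
  · exact (norm_pow_le _ _).trans (pow_le_one₀ (norm_nonneg _) norm_coordSnd_le)

/-- A continuous function with a power series expansion on the open bidisk is a uniform limit of
polynomials. -/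
theorem mem_algebra_of_hasCoeffsAt {f : C(Bidisk, ℂ)} {a : ℕ → ℕ → ℂ} (ha : HasCoeffsAt f a) :
    f ∈ algebra := by
  have key : 1 ∈ {c : closedBall (0 : ℂ) 1 | f.comp (scale c) ∈ algebra} := by
    refine one_mem_of_isClosed (isClosed_algebra.preimage (continuous_comp_scale f)) fun c hc => ?_
    have hs : Summable fun mn : ℕ × ℕ =>
        (a mn.1 mn.2 * (c : ℂ) ^ mn.1 * (c : ℂ) ^ mn.2) • (coordFst ^ mn.1 * coordSnd ^ mn.2) := by
      have h1 : Summable fun mn : ℕ × ℕ => ‖a mn.1 mn.2 * (c : ℂ) ^ mn.1 * (c : ℂ) ^ mn.2‖ :=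
        (ha ⟨(c, c), c.2, c.2⟩ hc hc).summable.norm
      refine h1.of_norm_bounded fun mn => ?_
      rw [norm_smul]
      exact mul_le_of_le_one_right (norm_nonneg _) (norm_monomial_le _ _)
    have he : f.comp (scale c) = ∑' mn : ℕ × ℕ,
        (a mn.1 mn.2 * (c : ℂ) ^ mn.1 * (c : ℂ) ^ mn.2) • (coordFst ^ mn.1 * coordSnd ^ mn.2) := by
      ext x
      rw [← ContinuousMap.tsum_apply hs]
      refine (ha (scale c x) (norm_scale_fst_lt hc x) (norm_scale_snd_lt hc x)).unique ?_
      convert! (ContinuousMap.hasSum_apply hs.hasSum x) using 2 with mn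
      · simp
        ring
      · exact ContinuousMap.tsum_apply hs x
    rw [Set.mem_ofPred_eq, he]
    exact isClosed_algebra.mem_of_tendsto hs.hasSum (Eventually.of_forall fun s =>
      algebra.sum_mem fun mn _ => algebra.smul_mem (algebra.mul_mem (algebra.pow_mem coordFst_mem _)
        (algebra.pow_mem coordSnd_mem _)) _)
  have h1 : f.comp (scale 1) = f := by
    ext x
    simp [scale_one]
  exact h1 ▸ key

/-! ### Power series coefficients -/

section Coeff

open MeasureTheory AddCircle

/-- The parametrization of the distinguished boundary. -/
def torus : C(UnitAddCircle × UnitAddCircle, Bidisk) where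
  toFun x := ⟨(fourier 1 x.1, fourier 1 x.2), by
    simp [Bidisk, fourier_apply, Circle.norm_coe]⟩
  continuous_toFun := by fun_prop

/-- The integrand of the Cauchy formula for power series coefficients. -/
def cauchyKernel (m n : ℕ) : C(UnitAddCircle × UnitAddCircle, ℂ) :=
  ⟨fun x => fourier (-m : ℤ) x.1 * fourier (-n : ℤ) x.2, by fun_prop⟩

theorem norm_cauchyKernel_apply (m n : ℕ) (x : UnitAddCircle × UnitAddCircle) :
    ‖cauchyKernel m n x‖ = 1 := by
  simp [cauchyKernel, fourier_apply, Circle.norm_coe]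

theorem integrable_torus (g : C(UnitAddCircle × UnitAddCircle, ℂ)) :
    Integrable g ((haarAddCircle (T := 1)).prod (haarAddCircle (T := 1))) :=
  g.continuous.integrable_of_hasCompactSupport (HasCompactSupport.of_compactSpace _)

/-- The power series coefficients, as continuous linear functionals. -/
def coeff (m n : ℕ) : C(Bidisk, ℂ) →L[ℂ] ℂ :=
  LinearMap.mkContinuous
    { toFun := fun f => ∫ x, (cauchyKernel m n * f.comp torus) x
        ∂((haarAddCircle (T := 1)).prod (haarAddCircle (T := 1)))
      map_add' := fun f g => by
        rw [← integral_add (integrable_torus _) (integrable_torus _)]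
        simp [mul_add]
      map_smul' := fun c f => by
        rw [RingHom.id_apply, ← integral_smul]
        congr 1
        ext x
        simp
        ring } 1 fun f => by
    rw [one_mul]
    refine (norm_integral_le_of_norm_le_const (C := ‖f‖) (Eventually.of_forall fun x => ?_)).trans
      (by simp)
    rw [ContinuousMap.mul_apply, norm_mul, norm_cauchyKernel_apply, one_mul]
    exact f.norm_coe_le_norm _

theorem norm_coeff_le (m n : ℕ) : ‖coeff m n‖ ≤ 1 := LinearMap.mkContinuous_norm_le _ zero_le_one _

theorem integral_fourier (n : ℤ) :
    ∫ x : UnitAddCircle, fourier n x ∂haarAddCircle = if n = 0 then 1 else 0 := by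
  split_ifs with h
  · simp [h]
  · exact integral_eq_zero_of_add_right_eq_neg (fourier_add_half_inv_index h one_pos)

theorem coeff_monomial (m n k l : ℕ) :
    coeff m n (coordFst ^ k * coordSnd ^ l) = if m = k ∧ n = l then 1 else 0 := by
  have hpow : ∀ (j : ℕ) (x : UnitAddCircle), fourier 1 x ^ j = (fourier (j : ℤ) x : ℂ) := by
    intro j x
    simp only [fourier_apply]
    rw [← Circle.coe_pow, ← AddCircle.toCircle_nsmul]
    simp
  have : coeff m n (coordFst ^ k * coordSnd ^ l) = ∫ x : UnitAddCircle × UnitAddCircle,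
      fourier (-m + k : ℤ) x.1 * fourier (-n + l : ℤ) x.2
        ∂((haarAddCircle (T := 1)).prod (haarAddCircle (T := 1))) := by
    change ∫ x, _ ∂_ = _
    congr 1
    ext x
    simp only [fourier_add, ← hpow]
    simp [cauchyKernel, torus]
    ring
  rw [this, integral_prod_mul (fun x : UnitAddCircle => (fourier (-m + k : ℤ) x : ℂ))
    (fun x : UnitAddCircle => (fourier (-n + l : ℤ) x : ℂ)), integral_fourier, integral_fourier]
  simp only [neg_add_eq_zero, Nat.cast_inj, mul_ite, mul_one, mul_zero]
  split_ifs <;> simp_all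

theorem hasSum_coeff {f : C(Bidisk, ℂ)} (hf : f ∈ algebra) :
    HasCoeffsAt f fun m n => coeff m n f := by
  intro x hz hw
  have hs : Summable fun mn : ℕ × ℕ =>
      ((x : ℂ × ℂ).1 ^ mn.1 * (x : ℂ × ℂ).2 ^ mn.2) • coeff mn.1 mn.2 := by
    have h1 : Summable fun mn : ℕ × ℕ => ‖(x : ℂ × ℂ).1‖ ^ mn.1 * ‖(x : ℂ × ℂ).2‖ ^ mn.2 :=
      (summable_geometric_of_lt_one (norm_nonneg _) hz).mul_of_nonneg
        (summable_geometric_of_lt_one (norm_nonneg _) hw) (fun _ => by positivity)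
        fun _ => by positivity
    refine h1.of_norm_bounded fun mn => ?_
    rw [norm_smul, norm_mul, norm_pow, norm_pow]
    exact mul_le_of_le_one_right (by positivity) (norm_coeff_le _ _)
  have happ : ∀ g : C(Bidisk, ℂ), HasSum (fun mn : ℕ × ℕ =>
      coeff mn.1 mn.2 g * (x : ℂ × ℂ).1 ^ mn.1 * (x : ℂ × ℂ).2 ^ mn.2)
      ((∑' mn : ℕ × ℕ, ((x : ℂ × ℂ).1 ^ mn.1 * (x : ℂ × ℂ).2 ^ mn.2) • coeff mn.1 mn.2) g) := by
    intro g
    convert! (ContinuousLinearMap.apply ℂ ℂ g).hasSum hs.hasSum using 2 with mn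
    simp
    ring
  convert! happ f using 1
  symm
  refine algebra_induction (P := fun g => (∑' mn : ℕ × ℕ, ((x : ℂ × ℂ).1 ^ mn.1 *
    (x : ℂ × ℂ).2 ^ mn.2) • coeff mn.1 mn.2) g = g x) ?_ ?_ ?_ ?_ ?_ hf
  · exact isClosed_eq (by fun_prop) (by fun_prop)
  · simp
  · intro g h hg hh
    rw [map_add, hg, hh, ContinuousMap.add_apply]
  · intro c g hg
    rw [map_smul, hg, ContinuousMap.smul_apply]
  · intro m n
    refine (happ _).unique ?_
    convert! hasSum_ite_eq (m, n) ((x : ℂ × ℂ).1 ^ m * (x : ℂ × ℂ).2 ^ n) using 2 with mn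
    · rw [coeff_monomial]
      obtain ⟨k, l⟩ := mn
      simp only [Prod.mk.injEq]
      split_ifs with h
      · simp [h]
      · simp

theorem coeff_comp_scale {f : C(Bidisk, ℂ)} (hf : f ∈ algebra) (c : closedBall (0 : ℂ) 1)
    (m n : ℕ) : coeff m n (f.comp (scale c)) = (c : ℂ) ^ (m + n) * coeff m n f := by
  refine algebra_induction
    (P := fun f => coeff m n (f.comp (scale c)) = (c : ℂ) ^ (m + n) * coeff m n f) ?_ ?_ ?_ ?_ ?_ hf
  · exact isClosed_eq ((coeff m n).continuous.comp (ContinuousMap.continuous_precomp _))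
      (by fun_prop)
  · simp
  · intro f g hf hg
    rw [ContinuousMap.add_comp, map_add, map_add, hf, hg, mul_add]
  · intro a f hf
    rw [ContinuousMap.smul_comp, map_smul, map_smul, hf, smul_eq_mul, smul_eq_mul]
    ring
  · intro k l
    have : (coordFst ^ k * coordSnd ^ l).comp (scale c)
        = ((c : ℂ) ^ (k + l)) • (coordFst ^ k * coordSnd ^ l) := by
      ext x
      simp
      ring
    rw [this, map_smul, coeff_monomial, smul_eq_mul]
    split_ifs with h
    · rw [h.1, h.2]
    · simp

end Coeff

/-! ### Points and maximal ideals -/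

theorem norm_character_le (χ : algebra →ₐ[ℂ] ℂ) {f : C(Bidisk, ℂ)} (hf : f ∈ algebra) :
    ‖χ ⟨f, hf⟩‖ ≤ ‖f‖ := by
  have : CompleteSpace algebra := isClosed_algebra.completeSpace_coe
  have h1 := AlgHom.norm_apply_le_self_mul_norm_one (𝕜 := ℂ) (A := algebra) χ ⟨f, hf⟩
  have h2 : ‖(1 : algebra)‖ = 1 := norm_one (α := C(Bidisk, ℂ))
  rw [h2, mul_one] at h1
  exact h1

theorem continuous_character (χ : algebra →ₐ[ℂ] ℂ) : Continuous χ := by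
  have : CompleteSpace algebra := isClosed_algebra.completeSpace_coe
  exact map_continuous χ

/-- Characters of the bidisk algebra are point evaluations. -/
theorem exists_eval (χ : algebra →ₐ[ℂ] ℂ) :
    ∃ q : Bidisk, ∀ f : algebra, χ f = (f : C(Bidisk, ℂ)) q := by
  have hq : (χ ⟨_, coordFst_mem⟩, χ ⟨_, coordSnd_mem⟩) ∈ Bidisk :=
    ⟨mem_closedBall_zero_iff.2 ((norm_character_le χ _).trans norm_coordFst_le),
      mem_closedBall_zero_iff.2 ((norm_character_le χ _).trans norm_coordSnd_le)⟩
  refine ⟨⟨_, hq⟩, ?_⟩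
  rintro ⟨f, hf⟩
  obtain ⟨u, hu, hlim⟩ := mem_closure_iff_seq_limit.1 hf
  have hpoly : ∀ (g : C(Bidisk, ℂ)) (hg : g ∈ Algebra.adjoin ℂ {coordFst, coordSnd}),
      χ ⟨g, adjoin_le_algebra hg⟩ = g ⟨_, hq⟩ := by
    intro g hg
    induction hg using Algebra.adjoin_induction with
    | mem x hx =>
      rcases hx with rfl | rfl
      · rfl
      · rfl
    | algebraMap r => exact χ.commutes r
    | add x y hx hy h1 h2 =>
      rw [ContinuousMap.add_apply, ← h1, ← h2]
      exact χ.toLinearMap.map_add (⟨x, adjoin_le_algebra hx⟩ : algebra) ⟨y, adjoin_le_algebra hy⟩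
    | mul x y hx hy h1 h2 =>
      rw [ContinuousMap.mul_apply, ← h1, ← h2]
      exact map_mul χ (⟨x, adjoin_le_algebra hx⟩ : algebra) ⟨y, adjoin_le_algebra hy⟩
  have h1 : Tendsto (fun n => χ ⟨u n, adjoin_le_algebra (hu n)⟩) atTop (𝓝 (χ ⟨f, hf⟩)) :=
    ((continuous_character χ).tendsto _).comp (tendsto_subtype_rng.2 hlim)
  have h2 : Tendsto (fun n => u n ⟨_, hq⟩) atTop (𝓝 (f ⟨_, hq⟩)) :=
    ((continuous_eval_const (⟨_, hq⟩ : Bidisk)).tendsto f).comp hlim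
  simp only [hpoly _ (hu _)] at h1
  exact tendsto_nhds_unique h1 h2

/-! ### Homogeneous elements -/

variable (p : ℕ)

/-- The standard primitive `p`-th root of unity. -/
def root : ℂ := Complex.exp (2 * Real.pi * Complex.I / p)

/-- The standard primitive `p`-th root of unity as an element of the unit disk. -/
def diskRoot : closedBall (0 : ℂ) 1 := ⟨root p, by
  have : (2 * Real.pi * Complex.I / p : ℂ) = ((2 * Real.pi / p : ℝ) : ℂ) * Complex.I := by
    push_cast
    ring
  rw [mem_closedBall_zero_iff, root, this, Complex.norm_exp_ofReal_mul_I]⟩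

@[simp] theorem coe_diskRoot : (diskRoot p : ℂ) = root p := rfl

/-- Elements of the bidisk algebra that are homogeneous of degree `k` modulo `p`. -/
def homogeneous (k : ℤ) : Submodule ℂ C(Bidisk, ℂ) where
  carrier := {f | f ∈ algebra ∧ ∀ x, f (scale (diskRoot p) x) = root p ^ k * f x}
  zero_mem' := ⟨algebra.zero_mem, by simp⟩
  add_mem' {f g} hf hg := ⟨algebra.add_mem hf.1 hg.1, fun x => by
    rw [ContinuousMap.add_apply, hf.2, hg.2, ContinuousMap.add_apply, mul_add]⟩
  smul_mem' c f hf := ⟨algebra.smul_mem hf.1 c, fun x => by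
    rw [ContinuousMap.smul_apply, hf.2, ContinuousMap.smul_apply, mul_smul_comm]⟩

variable {p}

theorem mem_homogeneous {k : ℤ} {f : C(Bidisk, ℂ)} : f ∈ homogeneous p k ↔
    f ∈ algebra ∧ ∀ x, f (scale (diskRoot p) x) = root p ^ k * f x := Iff.rfl

theorem root_ne_zero : root p ≠ 0 := Complex.exp_ne_zero _

instance : SetLike.GradedMonoid (homogeneous p) where
  one_mem := ⟨algebra.one_mem, by simp⟩
  mul_mem i j f g hf hg := ⟨algebra.mul_mem hf.1 hg.1, fun x => by
    rw [ContinuousMap.mul_apply, hf.2, hg.2, zpow_add₀ root_ne_zero, ContinuousMap.mul_apply]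
    ring⟩

theorem coordFst_mem_homogeneous : coordFst ∈ homogeneous p 1 := ⟨coordFst_mem, by simp⟩

theorem coordSnd_mem_homogeneous : coordSnd ∈ homogeneous p 1 := ⟨coordSnd_mem, by simp⟩

theorem root_zpow_eq_iff (hp : p ≠ 0) {k l : ℤ} : root p ^ k = root p ^ l ↔ k ≡ l [ZMOD p] := by
  rw [Int.modEq_iff_dvd, ← (Complex.isPrimitiveRoot_exp p hp).zpow_eq_one_iff_dvd]
  change _ ↔ root p ^ _ = 1
  rw [zpow_sub₀ root_ne_zero, div_eq_one_iff_eq (zpow_ne_zero _ root_ne_zero), eq_comm]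

theorem homogeneous_congr (hp : p ≠ 0) {k l : ℤ} (h : k ≡ l [ZMOD p]) :
    homogeneous p k = homogeneous p l := by
  ext f
  rw [mem_homogeneous, mem_homogeneous, (root_zpow_eq_iff hp).2 h]

theorem apply_zero_of_mem_homogeneous (hp : p ≠ 0) {k : ℤ} (hk : ¬ k ≡ 0 [ZMOD p])
    {f : C(Bidisk, ℂ)} (hf : f ∈ homogeneous p k) : f pt0 = 0 := by
  have h := hf.2 pt0
  have h0 : scale (diskRoot p) pt0 = pt0 := ext (by simp [pt0]) (by simp [pt0])
  rw [h0] at h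
  have h1 : root p ^ k ≠ 1 := fun h => hk ((root_zpow_eq_iff hp).1 (by simpa using h))
  by_contra hne
  exact h1 (mul_right_cancel₀ hne (by rw [← h, one_mul]))

/-- Homogeneity in terms of power series coefficients. -/
theorem mem_homogeneous_iff (hp : p ≠ 0) {k : ℤ} {f : C(Bidisk, ℂ)} : f ∈ homogeneous p k ↔
    ∃ a : ℕ → ℕ → ℂ, HasCoeffsAt f a ∧ ∀ m n : ℕ, ¬ (m + n : ℤ) ≡ k [ZMOD p] → a m n = 0 := by
  constructor
  · rintro ⟨hf, hk⟩
    refine ⟨fun m n => coeff m n f, hasSum_coeff hf, fun m n hmn => ?_⟩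
    have h1 : f.comp (scale (diskRoot p)) = root p ^ k • f := by
      ext x
      simpa using hk x
    have h2 := coeff_comp_scale hf (diskRoot p) m n
    rw [h1, map_smul, smul_eq_mul, coe_diskRoot] at h2
    by_contra hne
    refine hmn ((root_zpow_eq_iff hp).1 ?_)
    rw [mul_right_cancel₀ hne h2]
    norm_cast
  · rintro ⟨a, ha, hk⟩
    refine ⟨mem_algebra_of_hasCoeffsAt ha, fun x => ?_⟩
    have key : 1 ∈ {c : closedBall (0 : ℂ) 1 | f.comp (scale c) (scale (diskRoot p) x)
        = root p ^ k * f.comp (scale c) x} := by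
      refine one_mem_of_isClosed (isClosed_eq ?_ ?_) fun c hc => ?_
      · exact (continuous_eval_const _).comp (continuous_comp_scale f)
      · exact continuous_const.mul ((continuous_eval_const _).comp (continuous_comp_scale f))
      · refine (ha _ (norm_scale_fst_lt hc _) (norm_scale_snd_lt hc _)).unique ?_
        convert! (ha _ (norm_scale_fst_lt hc x) (norm_scale_snd_lt hc x)).mul_left (root p ^ k)
          using 2 with mn
        by_cases h : (mn.1 + mn.2 : ℤ) ≡ k [ZMOD p]
        · have : root p ^ k = root p ^ mn.1 * root p ^ mn.2 := by
            rw [← (root_zpow_eq_iff hp).2 h, ← pow_add]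
            norm_cast
          rw [this]
          simp
          ring
        · simp [hk _ _ h]
    simpa [scale_one] using key

/-- The projection of the bidisk algebra onto the elements of degree zero. -/
def average (p : ℕ) : C(Bidisk, ℂ) →ₗ[ℂ] C(Bidisk, ℂ) :=
  (p : ℂ)⁻¹ • ∑ k ∈ Finset.range p,
    (ContinuousMap.compRightAlgHom ℂ ℂ (scale (diskRoot p ^ k))).toLinearMap

theorem average_apply (f : C(Bidisk, ℂ)) (x : Bidisk) :
    average p f x = (p : ℂ)⁻¹ * ∑ k ∈ Finset.range p, f (scale (diskRoot p ^ k) x) := by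
  simp [average]

theorem average_mem (hp : p ≠ 0) {f : C(Bidisk, ℂ)} (hf : f ∈ algebra) :
    average p f ∈ homogeneous p 0 := by
  refine ⟨?_, fun x => ?_⟩
  · simp only [average, LinearMap.smul_apply, LinearMap.sum_apply]
    exact algebra.smul_mem (algebra.sum_mem fun k _ => comp_scale_mem hf _) _
  · have hone : diskRoot p ^ p = 1 := Subtype.ext (by
      simpa [root] using (Complex.isPrimitiveRoot_exp p hp).pow_eq_one)
    have h := Finset.sum_range_succ (fun k => f (scale (diskRoot p ^ k) x)) p
    rw [Finset.sum_range_succ', hone, pow_zero, add_left_inj] at h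
    rw [average_apply, average_apply, zpow_zero, one_mul, ← h]
    simp only [pow_succ, scale_mul]

theorem scale_pow_apply {f : C(Bidisk, ℂ)} (hf : f ∈ homogeneous p 0) (k : ℕ) (x : Bidisk) :
    f (scale (diskRoot p ^ k) x) = f x := by
  induction k with
  | zero => rw [pow_zero, scale_one]
  | succ k ih => rw [pow_succ', scale_mul, hf.2, zpow_zero, one_mul, ih]

theorem average_mul {f : C(Bidisk, ℂ)} (hf : f ∈ homogeneous p 0) (g : C(Bidisk, ℂ)) :
    average p (g * f) = average p g * f := by
  ext x
  simp only [average_apply, ContinuousMap.mul_apply, scale_pow_apply hf, ← Finset.sum_mul,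
    mul_assoc]

theorem average_one (hp : p ≠ 0) : average p 1 = 1 := by
  ext x
  simp [average_apply, hp]

variable {J : Set (Matrix (Fin p) (Fin p) C(Bidisk, ℂ))}

/-- The degree-zero scalars in a maximal two-sided ideal are those vanishing at some point. -/
theorem exists_point (hp : p ≠ 0) (hJ : IsMaxIdealIn (gradedMatrix (homogeneous p) p : Set _) J) :
    ∃ q : Bidisk, ∀ f ∈ homogeneous p 0, f q = 0 →
      f • (1 : Matrix (Fin p) (Fin p) C(Bidisk, ℂ)) ∈ J := by
  let I : Ideal algebra := Ideal.span {f | (f : C(Bidisk, ℂ)) ∈ homogeneous p 0 ∧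
    (f : C(Bidisk, ℂ)) • (1 : Matrix (Fin p) (Fin p) C(Bidisk, ℂ)) ∈ J}
  have havg : ∀ f ∈ I, ∀ g : algebra, average p ((g * f : algebra) : C(Bidisk, ℂ)) •
      (1 : Matrix (Fin p) (Fin p) C(Bidisk, ℂ)) ∈ J := by
    intro f hf
    induction hf using Submodule.span_induction with
    | mem f hf =>
      intro g
      rw [MulMemClass.coe_mul, average_mul hf.1, mul_comm, mul_smul]
      have := smul_mem_of_smul_one_mem hJ.1 hf.2
        (smul_mem_gradedMatrix (average_mem hp g.2) (Subalgebra.one_mem _))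
      exact this
    | zero =>
      intro g
      simpa using hJ.1.2.1
    | add x y _ _ hx hy =>
      intro g
      rw [mul_add, AddMemClass.coe_add, map_add, add_smul]
      exact hJ.1.add (hx g) (hy g)
    | smul a x _ hx =>
      intro g
      rw [smul_eq_mul, ← mul_assoc]
      exact hx _
  have hI : I ≠ ⊤ := fun h => hJ.one_notMem (by
    simpa [average_one hp] using havg 1 (h ▸ Submodule.mem_top) 1)
  obtain ⟨M, hM, hIM⟩ := Ideal.exists_le_maximal I hI
  have : CompleteSpace algebra := isClosed_algebra.completeSpace_coe
  obtain ⟨q, hq⟩ := exists_eval (WeakDual.CharacterSpace.toAlgHom M.toCharacterSpace)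
  have hvan : ∀ f ∈ homogeneous p 0,
      f • (1 : Matrix (Fin p) (Fin p) C(Bidisk, ℂ)) ∈ J → f q = 0 := fun f hf hfJ => by
    rw [← hq ⟨f, hf.1⟩]
    exact M.toCharacterSpace_apply_eq_zero_of_mem (hIM (Ideal.subset_span ⟨hf, hfJ⟩))
  refine ⟨q, fun f hf hfq => ?_⟩
  by_contra hfJ
  obtain ⟨g, hg, h⟩ := exists_one_sub_mul_smul_one_mem hJ hf hfJ
  have hfg : f * g ∈ homogeneous p 0 := by simpa using SetLike.mul_mem_graded hf hg
  have := hvan _ (Submodule.sub_mem _ (SetLike.one_mem_graded _) hfg) h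
  simp [hfq] at this

theorem exists_hasCodimIn (hp : p ≠ 0)
    (hJ : IsMaxIdealIn (gradedMatrix (homogeneous p) p : Set _) J) :
    ∃ d : ℕ, (d = 1 ∨ d = p ^ 2) ∧
      HasCodimIn (gradedMatrix (homogeneous p) p : Set _) J d := by
  obtain ⟨q, hq⟩ := exists_point hp hJ
  let ev : C(Bidisk, ℂ) →ₐ[ℂ] ℂ := ContinuousMap.evalAlgHom ℂ ℂ q
  have hper : ∀ k l : ℤ, k ≡ l [ZMOD p] → homogeneous p k = homogeneous p l := fun _ _ =>
    homogeneous_congr hp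
  by_cases h1 : (q : ℂ × ℂ).1 = 0
  · by_cases h2 : (q : ℂ × ℂ).2 = 0
    · obtain rfl : q = pt0 := ext h1 h2
      exact ⟨1, Or.inl rfl, hasCodimIn_one hJ ev hq fun k hk f hf =>
        apply_zero_of_mem_homogeneous hp hk hf⟩
    · exact ⟨p ^ 2, Or.inr rfl, hasCodimIn_sq hJ hper ev hq coordSnd_mem_homogeneous h2⟩
  · exact ⟨p ^ 2, Or.inr rfl, hasCodimIn_sq hJ hper ev hq coordFst_mem_homogeneous h1⟩

end Bidisk

/-- Matrices of continuous functions are continuous matrix-valued functions. -/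
def matrixContinuousMapEquiv (X n : Type*) [TopologicalSpace X] [Fintype n] [DecidableEq n] :
    Matrix n n C(X, ℂ) ≃+* C(X, Matrix n n ℂ) where
  toFun M := ⟨fun x => Matrix.of fun i j => M i j x,
    continuous_matrix fun i j => (M i j).continuous⟩
  invFun F := Matrix.of fun i j => ⟨fun x => F x i j, F.continuous.matrix_elem i j⟩
  left_inv _ := rfl
  right_inv _ := rfl
  map_add' _ _ := rfl
  map_mul' M N := by
    ext x i j
    simp [Matrix.mul_apply]

theorem preimage_memBk2 {p : ℕ} (hp : p ≠ 0) :
    matrixContinuousMapEquiv Bidisk (Fin p) ⁻¹' {F | memBk2 p F}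
      = gradedMatrix (Bidisk.homogeneous p) p := by
  ext M
  exact forall_congr' fun i => forall_congr' fun j => (Bidisk.mem_homogeneous_iff hp).symm

/-- for every maximal proper two-sided ideal `J` of `B_{p,2}`, the quotient
`B_{p,2}/J` is finite dimensional over `ℂ`, of dimension either `1` or `p²`. -/
theorem stmt13 (p : ℕ) (hp : 1 ≤ p) (J : Set C(Bidisk, Matrix (Fin p) (Fin p) ℂ))
    (hJ : IsMaxIdealIn {F : C(Bidisk, Matrix (Fin p) (Fin p) ℂ) | memBk2 p F} J) :
    ∃ d : ℕ, (d = 1 ∨ d = p ^ 2) ∧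
      HasCodimIn {F : C(Bidisk, Matrix (Fin p) (Fin p) ℂ) | memBk2 p F} J d := by
  have hp0 : p ≠ 0 := by omega
  have hJ' := hJ.preimage (matrixContinuousMapEquiv Bidisk (Fin p))
  rw [preimage_memBk2 hp0] at hJ'
  obtain ⟨d, hd, h⟩ := Bidisk.exists_hasCodimIn hp0 hJ'
  rw [← preimage_memBk2 hp0] at h
  exact ⟨d, hd, h.of_preimage _ fun _ _ => rfl⟩
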